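/- Let x̄ be a weak local minimizer of problem (P), and suppose f and g are Fréchet differentiable at x̄. Then for every direction u ∈ ℝ^s there exists a pair (λ,μ) ∈ Λ (so λ ∈ C*, μ ∈ K*, Σ|λ_i| + Σ|μ_j| = 1) such that [λ·∇f(x̄) + μ·∇g(x̄)] u ≥ 0. -/

import Mathlib

open Filter Topology Pointwise

noncomputable section

/-- Euclidean dot product on `Fin n → ℝ`. -/
def dotp {n : ℕ} (a b : Fin n → ℝ) : ℝ := ∑ i, a i * b i

/-- Positive polar cone `C* = {l | l·x ≥ 0 for all x ∈ C}`. -/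
def polarCone {n : ℕ} (C : Set (Fin n → ℝ)) : Set (Fin n → ℝ) :=
  {l | ∀ x ∈ C, 0 ≤ dotp l x}

/-- A closed convex pointed cone with vertex at the origin. -/
def IsClosedConvexPointedCone {n : ℕ} (C : Set (Fin n → ℝ)) : Prop :=
  IsClosed C ∧ Convex ℝ C ∧ (0 : Fin n → ℝ) ∈ C ∧
    (∀ c : ℝ, 0 ≤ c → ∀ x ∈ C, c • x ∈ C) ∧ C ∩ (-C) ⊆ {0}

/-- The set Λ of normalized multiplier pairs. -/
def LambdaSet {n m : ℕ} (C : Set (Fin n → ℝ)) (K : Set (Fin m → ℝ)) :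
    Set ((Fin n → ℝ) × (Fin m → ℝ)) :=
  {p | p.1 ∈ polarCone C ∧ p.2 ∈ polarCone K ∧
    (∑ i, |p.1 i|) + (∑ j, |p.2 j|) = 1}

/-- `x̄` is a weak local minimizer of problem (P): no feasible point near `x̄`
has `f x ∈ f x̄ − int C`. -/
def WeakLocalMin {s n m : ℕ} (C : Set (Fin n → ℝ)) (K : Set (Fin m → ℝ))
    (X : Set (Fin s → ℝ)) (f : (Fin s → ℝ) → (Fin n → ℝ))
    (g : (Fin s → ℝ) → (Fin m → ℝ)) (xbar : Fin s → ℝ) : Prop :=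
  ∃ N ∈ 𝓝 xbar, ∀ x ∈ N, x ∈ X → g x ∈ -K →
    f x ∉ ({f xbar} : Set (Fin n → ℝ)) - interior C

/-- The auxiliary function `F(x) = sup{λ·(f x − f x̄) + μ·g x : (λ,μ) ∈ Λ}`. -/
def Ffun {s n m : ℕ} (C : Set (Fin n → ℝ)) (K : Set (Fin m → ℝ))
    (f : (Fin s → ℝ) → (Fin n → ℝ)) (g : (Fin s → ℝ) → (Fin m → ℝ))
    (xbar x : Fin s → ℝ) : ℝ :=
  sSup ((fun p => dotp p.1 (f x - f xbar) + dotp p.2 (g x)) '' LambdaSet C K)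

theorem dotp_neg_right {n : ℕ} (a b : Fin n → ℝ) : dotp a (-b) = -dotp a b := by
  simp [dotp]

theorem dotp_zero_left {n : ℕ} (b : Fin n → ℝ) : dotp 0 b = 0 := by
  simp [dotp]

theorem dotp_sub_right {n : ℕ} (a b c : Fin n → ℝ) :
    dotp a (b - c) = dotp a b - dotp a c := by
  simp [dotp, mul_sub]

theorem dotp_smul_left {n : ℕ} (r : ℝ) (a b : Fin n → ℝ) :
    dotp (r • a) b = r * dotp a b := by
  simp [dotp, Finset.mul_sum, mul_assoc]

theorem continuous_dotp_left {n : ℕ} (b : Fin n → ℝ) : Continuous fun a => dotp a b := by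
  unfold dotp
  fun_prop

theorem abs_dotp_le {n : ℕ} (a b : Fin n → ℝ) : |dotp a b| ≤ (∑ i, |a i|) * ‖b‖ := by
  rw [dotp, Finset.sum_mul]
  refine (Finset.abs_sum_le_sum_abs _ _).trans (Finset.sum_le_sum fun i _ => ?_)
  rw [abs_mul]
  exact mul_le_mul_of_nonneg_left (norm_le_pi_norm b i) (abs_nonneg _)

theorem exists_dotp_eq {n : ℕ} (φ : (Fin n → ℝ) →L[ℝ] ℝ) : ∃ l, ∀ x, φ x = dotp l x := by
  refine ⟨fun i => φ (Pi.single i 1), fun x => ?_⟩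
  conv_lhs => rw [pi_eq_sum_univ' x]
  rw [map_sum]
  refine Finset.sum_congr rfl fun i _ => ?_
  rw [map_smul, smul_eq_mul, mul_comm]

theorem isCompact_polarCone_inter_sphere {n : ℕ} (C : Set (Fin n → ℝ)) :
    IsCompact {l | l ∈ polarCone C ∧ ∑ i, |l i| = 1} := by
  refine Metric.isCompact_of_isClosed_isBounded ?_ ?_
  · refine IsClosed.inter ?_ (isClosed_eq (by fun_prop) continuous_const)
    have : polarCone C = ⋂ x ∈ C, {l | 0 ≤ dotp l x} := by
      ext l
      simp [polarCone]
    rw [this]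
    exact isClosed_biInter fun x _ => isClosed_le continuous_const (continuous_dotp_left x)
  · refine (Metric.isBounded_closedBall (x := (0 : Fin n → ℝ)) (r := 1)).subset ?_
    rintro l ⟨-, hl⟩
    rw [mem_closedBall_zero_iff, pi_norm_le_iff_of_nonneg zero_le_one]
    intro i
    rw [← hl]
    exact Finset.single_le_sum (f := fun i => |l i|) (fun j _ => abs_nonneg _)
      (Finset.mem_univ i)

/-- A point outside a closed convex cone is separated from it by a normalized element of the
polar cone. -/
theorem exists_mem_polarCone_dotp_neg {n : ℕ} {C : Set (Fin n → ℝ)}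
    (hC : IsClosedConvexPointedCone C) {w : Fin n → ℝ} (hw : w ∉ C) :
    ∃ l ∈ polarCone C, ∑ i, |l i| = 1 ∧ dotp l w < 0 := by
  obtain ⟨hcl, hconv, h0, hsmul, -⟩ := hC
  obtain ⟨φ, u, hφ, hu⟩ := geometric_hahn_banach_closed_point hconv hcl hw
  obtain ⟨l, hl⟩ := exists_dotp_eq (-φ)
  have hu0 : 0 < u := by simpa using hφ 0 h0
  have hlw : dotp l w < 0 := by
    rw [← hl, neg_apply]
    linarith
  have hlC : ∀ x ∈ C, 0 ≤ dotp l x := by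
    intro x hx
    rw [← hl, neg_apply, neg_nonneg]
    by_contra! hpos
    have := hφ _ (hsmul (u / φ x) (div_nonneg hu0.le hpos.le) x hx)
    rw [map_smul, smul_eq_mul, div_mul_cancel₀ _ hpos.ne'] at this
    exact lt_irrefl _ this
  have hs : 0 < ∑ i, |l i| := by
    refine (Finset.sum_nonneg fun i _ => abs_nonneg (l i)).lt_of_ne' fun h => ?_
    have := abs_dotp_le l w
    rw [h, zero_mul] at this
    linarith [neg_abs_le (dotp l w)]
  refine ⟨(∑ i, |l i|)⁻¹ • l, fun x hx => ?_, ?_, ?_⟩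
  · rw [dotp_smul_left]
    exact mul_nonneg (inv_nonneg.2 hs.le) (hlC x hx)
  · simp only [Pi.smul_apply, smul_eq_mul, abs_mul, abs_of_pos (inv_pos.2 hs)]
    rw [← Finset.mul_sum, inv_mul_cancel₀ hs.ne']
  · rw [dotp_smul_left]
    exact mul_neg_of_pos_of_neg (inv_pos.2 hs) hlw

theorem mem_interior_of_dotp_pos {n : ℕ} {C : Set (Fin n → ℝ)}
    (hC : IsClosedConvexPointedCone C) {w : Fin n → ℝ}
    (hw : ∀ l ∈ polarCone C, ∑ i, |l i| = 1 → 0 < dotp l w) : w ∈ interior C := by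
  obtain ⟨δ, hδ, hδw⟩ : ∃ δ > 0, ∀ l ∈ polarCone C, ∑ i, |l i| = 1 → δ ≤ dotp l w := by
    obtain hne | hne := {l | l ∈ polarCone C ∧ ∑ i, |l i| = 1}.eq_empty_or_nonempty
    · exact ⟨1, one_pos, fun l h₁ h₂ => (Set.eq_empty_iff_forall_notMem.1 hne l ⟨h₁, h₂⟩).elim⟩
    · obtain ⟨l₀, hl₀, hmin⟩ := (isCompact_polarCone_inter_sphere C).exists_isMinOn hne
        (continuous_dotp_left w).continuousOn
      exact ⟨dotp l₀ w, hw l₀ hl₀.1 hl₀.2, fun l h₁ h₂ => hmin ⟨h₁, h₂⟩⟩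
  refine mem_interior.2 ⟨Metric.ball w δ, fun y hy => ?_, Metric.isOpen_ball,
    Metric.mem_ball_self hδ⟩
  by_contra hyC
  obtain ⟨l, hl, hl1, hneg⟩ := exists_mem_polarCone_dotp_neg hC hyC
  have h₁ := abs_dotp_le l (y - w)
  rw [hl1, one_mul, dotp_sub_right] at h₁
  have h₂ := neg_abs_le (dotp l y - dotp l w)
  have h₃ := hδw l hl hl1
  rw [mem_ball_iff_norm] at hy
  linarith

theorem smul_mem_interior_of_pos {n : ℕ} {C : Set (Fin n → ℝ)}
    (hC : IsClosedConvexPointedCone C) {t : ℝ} (ht : 0 < t) {w : Fin n → ℝ}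
    (hw : w ∈ interior C) : t • w ∈ interior C := by
  have hsub : t • C ⊆ C := by
    rintro _ ⟨x, hx, rfl⟩
    exact hC.2.2.2.1 t ht.le x hx
  refine interior_mono hsub ?_
  rw [interior_smul₀ ht.ne']
  exact Set.smul_mem_smul_set hw

theorem add_mem_of_isClosedConvexPointedCone {n : ℕ} {C : Set (Fin n → ℝ)}
    (hC : IsClosedConvexPointedCone C) {x y : Fin n → ℝ} (hx : x ∈ C) (hy : y ∈ C) :
    x + y ∈ C := by
  have h := hC.2.2.2.1 2 zero_le_two _
    (hC.2.1 hx hy (by norm_num : (0 : ℝ) ≤ 1 / 2) (by norm_num : (0 : ℝ) ≤ 1 / 2) (by norm_num))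
  simpa [smul_add, smul_smul] using h

/-- If `x̄` is a weak local minimizer of (P) and `f`, `g` are Fréchet differentiable
at `x̄`, then for every direction `u` there is `(λ,μ) ∈ Λ` with
`[λ·∇f(x̄) + μ·∇g(x̄)] u ≥ 0`. -/
theorem stmt_4 {s n m : ℕ}
    (C : Set (Fin n → ℝ)) (K : Set (Fin m → ℝ))
    (hC : IsClosedConvexPointedCone C) (hK : IsClosedConvexPointedCone K)
    (hCint : (interior C).Nonempty)
    (X : Set (Fin s → ℝ)) (hX : IsOpen X)
    (f : (Fin s → ℝ) → (Fin n → ℝ)) (g : (Fin s → ℝ) → (Fin m → ℝ))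
    (xbar : Fin s → ℝ) (hxX : xbar ∈ X) (hxfeas : g xbar ∈ -K)
    (hmin : WeakLocalMin C K X f g xbar)
    (Df : (Fin s → ℝ) →L[ℝ] (Fin n → ℝ)) (hDf : HasFDerivAt f Df xbar)
    (Dg : (Fin s → ℝ) →L[ℝ] (Fin m → ℝ)) (hDg : HasFDerivAt g Dg xbar) :
    ∀ u : Fin s → ℝ, ∃ p ∈ LambdaSet C K,
      0 ≤ dotp p.1 (Df u) + dotp p.2 (Dg u) := by
  intro u
  by_contra! hneg
  have hfu : -Df u ∈ interior C := mem_interior_of_dotp_pos hC fun l hl hl1 => by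
    have := hneg (l, 0) ⟨hl, fun x _ => (dotp_zero_left x).ge, by simpa using hl1⟩
    rw [dotp_zero_left, add_zero] at this
    rw [dotp_neg_right]
    exact neg_pos.2 this
  have hgu : -Dg u ∈ interior K := mem_interior_of_dotp_pos hK fun l hl hl1 => by
    have := hneg (0, l) ⟨fun x _ => (dotp_zero_left x).ge, hl, by simpa using hl1⟩
    rw [dotp_zero_left, zero_add] at this
    rw [dotp_neg_right]
    exact neg_pos.2 this
  obtain ⟨N, hN, hmin⟩ := hmin
  have hcont : Tendsto (fun t : ℝ => xbar + t • u) (𝓝[>] 0) (𝓝 xbar) := by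
    have : Continuous fun t : ℝ => xbar + t • u := by fun_prop
    simpa using (this.tendsto 0).mono_left nhdsWithin_le_nhds
  have hf := (hDf.hasLineDerivAt u).tendsto_slope_zero_right.neg.eventually
    (isOpen_interior.mem_nhds hfu)
  have hg := (hDg.hasLineDerivAt u).tendsto_slope_zero_right.neg.eventually
    (isOpen_interior.mem_nhds hgu)
  obtain ⟨t, htN, htX, htf, htg, ht⟩ := ((hcont.eventually hN).and
    ((hcont.eventually (hX.mem_nhds hxX)).and (hf.and (hg.and self_mem_nhdsWithin)))).exists
  have ht : 0 < t := ht
  refine hmin _ htN htX ?_ ?_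
  · have h := add_mem_of_isClosedConvexPointedCone hK hxfeas
      (interior_subset (smul_mem_interior_of_pos hK ht htg))
    rw [smul_neg, smul_inv_smul₀ ht.ne'] at h
    rw [Set.mem_neg]
    convert h using 1
    abel
  · have h := smul_mem_interior_of_pos hC ht htf
    rw [smul_neg, smul_inv_smul₀ ht.ne'] at h
    exact Set.mem_sub.2 ⟨_, rfl, _, h, by abel⟩
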